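/- arXiv:2003.12489 — 4 statements merged into one kernel-verified Lean document; each statement's English description precedes it below -/
import Mathlib

section
/- Let ρ be an N-partite density matrix of local dimension d with N ≥ 3 whose N-partite dependence attains the maximal quantum value, D_N(ρ) = 2 log d. Then ρ is (N−1)-uniform: for every party i, the marginal of ρ on the remaining N−1 parties (the partial trace of ρ over party i) equals d^{−(N−1)} times the identity matrix. -/
open Matrix ComplexOrder

/-- Von Neumann entropy `S(ρ) = −Σ_i λ_i log λ_i` (natural logarithm, `0 log 0 = 0`),
where `λ_i` are the eigenvalues of the (Hermitian) matrix `ρ`; junk value `0` for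
non-Hermitian matrices. -/
noncomputable def vNEntropy {n : Type*} [Fintype n] [DecidableEq n]
    (ρ : Matrix n n ℂ) : ℝ :=
  if h : ρ.IsHermitian then ∑ i, Real.negMulLog (h.eigenvalues i) else 0

/-- The configuration on `Fin N` agreeing with `a` off `T` and with `c` on `T`. -/
def mergeOn {N d : ℕ} (T : Finset (Fin N)) (a : {i : Fin N // i ∉ T} → Fin d)
    (c : {i : Fin N // i ∈ T} → Fin d) : Fin N → Fin d :=
  fun i => if h : i ∈ T then c ⟨i, h⟩ else a ⟨i, h⟩

/-- Partial trace over the set `T` of parties: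
`(Tr_T ρ)_{a,b} = Σ_c ρ_{(a⊔c),(b⊔c)}` with `c` running over configurations on `T`. -/
noncomputable def ptrace {N d : ℕ} (T : Finset (Fin N))
    (ρ : Matrix (Fin N → Fin d) (Fin N → Fin d) ℂ) :
    Matrix ({i : Fin N // i ∉ T} → Fin d) ({i : Fin N // i ∉ T} → Fin d) ℂ :=
  Matrix.of fun a b => ∑ c : {i : Fin N // i ∈ T} → Fin d,
    ρ (mergeOn T a c) (mergeOn T b c)

/-- `N`-partite dependence of an `N`-partite density matrix of local dimension `d`:
the minimum over pairs of distinct indices `i ≠ j` of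
`S(Tr_{{i}} ρ) + S(Tr_{{j}} ρ) − S(Tr_{{i,j}} ρ) − S(ρ)` (as an infimum of the
finite nonempty set of such values). -/
noncomputable def depQ {N d : ℕ} (ρ : Matrix (Fin N → Fin d) (Fin N → Fin d) ℂ) : ℝ :=
  sInf {x | ∃ i j : Fin N, i ≠ j ∧
    x = vNEntropy (ptrace {i} ρ) + vNEntropy (ptrace {j} ρ)
        - vNEntropy (ptrace {i, j} ρ) - vNEntropy ρ}

namespace DepAux

lemma vN_eq_roots {n : Type*} [Fintype n] [DecidableEq n] {σ : Matrix n n ℂ}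
    (h : σ.IsHermitian) :
    vNEntropy σ = (σ.charpoly.roots.map (fun z => Real.negMulLog z.re)).sum := by
  rw [vNEntropy, dif_pos h, h.roots_charpoly_eq_eigenvalues, Multiset.map_map]
  rfl

lemma vN_reindex {n m : Type*} [Fintype n] [DecidableEq n] [Fintype m] [DecidableEq m]
    (e : n ≃ m) {σ : Matrix n n ℂ} (h : σ.IsHermitian) :
    vNEntropy (σ.submatrix e.symm e.symm) = vNEntropy σ := by
  have h' : (σ.submatrix e.symm e.symm).IsHermitian := h.submatrix _
  rw [vN_eq_roots h, vN_eq_roots h']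
  have := Matrix.charpoly_reindex e σ
  rw [Matrix.reindex_apply] at this
  rw [this]

lemma vN_mul_comm {n m : Type*} [Fintype n] [DecidableEq n] [Fintype m] [DecidableEq m]
    (X : Matrix n m ℂ) :
    vNEntropy (X * Xᴴ) = vNEntropy (Xᴴ * X) := by
  rw [vN_eq_roots (Matrix.isHermitian_mul_conjTranspose_self X),
    vN_eq_roots (Matrix.isHermitian_conjTranspose_mul_self X)]
  have key : ∀ (k : ℕ) (p : Polynomial ℂ), p.Monic →
      ((Polynomial.X ^ k * p).roots.map (fun z : ℂ => Real.negMulLog z.re)).sum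
        = (p.roots.map (fun z : ℂ => Real.negMulLog z.re)).sum := by
    intro k p hp
    rw [Polynomial.roots_mul (((Polynomial.monic_X_pow k).mul hp).ne_zero)]
    simp [Multiset.map_nsmul, Multiset.sum_nsmul]
  rw [← key (Fintype.card m) _ (Matrix.charpoly_monic (X * Xᴴ)), Matrix.charpoly_mul_comm',
    key _ _ (Matrix.charpoly_monic _)]

lemma term_nonneg {p q w : ℝ} (hp : 0 ≤ p) (hq : 0 ≤ q) (hw : 0 ≤ w) (h : q = 0 → w * p = 0) :
    0 ≤ w * (p * Real.log p - p * Real.log q - p + q) ∧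
    (w * (p * Real.log p - p * Real.log q - p + q) = 0 → w = 0 ∨ p = q) := by
  rcases hw.eq_or_lt with hw0 | hw0
  · simp [← hw0]
  rcases hp.eq_or_lt with hp0 | hp0
  · subst hp0
    constructor
    · simp; positivity
    · intro h; simp at h; rcases h with h | h <;> simp [h]
  rcases hq.eq_or_lt with hq0 | hq0
  · have := h hq0.symm
    have : 0 < w * p := by positivity
    linarith
  have e : p * Real.log p - p * Real.log q - p + q = p * ((q / p - 1) - Real.log (q / p)) := by
    rw [Real.log_div hq0.ne' hp0.ne']; field_simp; ring
  have hr : 0 < q / p := by positivity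
  rw [e]
  constructor
  · have := Real.log_le_sub_one_of_pos hr
    have : 0 ≤ (q / p - 1) - Real.log (q / p) := by linarith
    positivity
  · intro h0
    right
    by_contra hne
    have h1 : q / p ≠ 1 := by
      intro h; rw [div_eq_one_iff_eq hp0.ne'] at h; exact hne h.symm
    have := Real.log_lt_sub_one_of_pos hr h1
    have : 0 < (q / p - 1) - Real.log (q / p) := by linarith
    have : 0 < w * (p * ((q / p - 1) - Real.log (q / p))) := by positivity
    linarith

lemma klein {n : Type*} [Fintype n] [DecidableEq n] {σ : Matrix n n ℂ} (hσ : σ.PosSemidef)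
    (W : Matrix n n ℂ) (hW : Wᴴ * W = 1) (t : n → ℝ) (ht : ∀ k, 0 ≤ t k)
    (hsum : ((∑ k, t k : ℝ) : ℂ) = σ.trace)
    (h0 : ∀ k, t k = 0 → (Wᴴ * σ * W) k k = 0) :
    vNEntropy σ ≤ -∑ k, ((Wᴴ * σ * W) k k).re * Real.log (t k) ∧
    (vNEntropy σ = -∑ k, ((Wᴴ * σ * W) k k).re * Real.log (t k) →
      σ = W * Matrix.diagonal (fun k => (t k : ℂ)) * Wᴴ) := by
  set p := hσ.1.eigenvalues with hp
  have hp0 : ∀ i, 0 ≤ p i := fun i => hσ.eigenvalues_nonneg i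
  obtain ⟨U, hU1, hU2, hsp⟩ : ∃ U : Matrix n n ℂ, Uᴴ * U = 1 ∧ U * Uᴴ = 1 ∧
      σ = U * Matrix.diagonal (fun i => (p i : ℂ)) * Uᴴ := by
    refine ⟨hσ.1.eigenvectorUnitary, ?_, ?_, ?_⟩
    · exact Unitary.coe_star_mul_self hσ.1.eigenvectorUnitary
    · exact Unitary.coe_mul_star_self hσ.1.eigenvectorUnitary
    · conv_lhs => rw [hσ.1.spectral_theorem, Unitary.conjStarAlgAut_apply]
      rfl
  have hW' : W * Wᴴ = 1 := mul_eq_one_comm.mp hW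
  set G := Uᴴ * W with hG
  have hG1 : Gᴴ * G = 1 := by
    rw [hG, conjTranspose_mul, conjTranspose_conjTranspose]
    calc Wᴴ * U * (Uᴴ * W) = Wᴴ * (U * Uᴴ) * W := by simp only [Matrix.mul_assoc]
      _ = 1 := by rw [hU2, Matrix.mul_one, hW]
  have hG2 : G * Gᴴ = 1 := mul_eq_one_comm.mp hG1
  have hUG : U * G = W := by rw [hG, ← Matrix.mul_assoc, hU2, Matrix.one_mul]
  set w : n → n → ℝ := fun i k => Complex.normSq (G i k) with hw
  have hw0 : ∀ i k, 0 ≤ w i k := fun i k => Complex.normSq_nonneg _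
  have row : ∀ i, ∑ k, w i k = 1 := by
    intro i
    have := congrFun (congrFun hG2 i) i
    rw [Matrix.mul_apply, Matrix.one_apply_eq] at this
    have h2 : ((∑ k, w i k : ℝ) : ℂ) = 1 := by
      rw [← this]; push_cast
      refine Finset.sum_congr rfl fun k _ => ?_
      rw [conjTranspose_apply, hw]; exact (Complex.mul_conj _).symm
    exact_mod_cast h2
  have col : ∀ k, ∑ i, w i k = 1 := by
    intro i
    have := congrFun (congrFun hG1 i) i
    rw [Matrix.mul_apply, Matrix.one_apply_eq] at this
    have h2 : ((∑ k, w k i : ℝ) : ℂ) = 1 := by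
      rw [← this]; push_cast
      refine Finset.sum_congr rfl fun k _ => ?_
      rw [conjTranspose_apply, hw, mul_comm]; exact (Complex.mul_conj _).symm
    exact_mod_cast h2
  have hdiag : ∀ k, (Wᴴ * σ * W) k k = ((∑ i, w i k * p i : ℝ) : ℂ) := by
    intro k
    have : Wᴴ * σ * W = Gᴴ * (Matrix.diagonal (fun i => (p i : ℂ)) * G) := by
      rw [hsp, hG, conjTranspose_mul, conjTranspose_conjTranspose]
      simp only [Matrix.mul_assoc]
    rw [this, Matrix.mul_apply]
    push_cast
    refine Finset.sum_congr rfl fun i _ => ?_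
    rw [Matrix.diagonal_mul, conjTranspose_apply, hw]
    simp only
    rw [← Complex.mul_conj]
    simp only [Complex.star_def]
    ring
  have hdiag' : ∀ k, ((Wᴴ * σ * W) k k).re = ∑ i, w i k * p i := by
    intro k; rw [hdiag, Complex.ofReal_re]
  have hterm : ∀ i k, t k = 0 → w i k * p i = 0 := by
    intro i k hk
    have := h0 k hk
    rw [hdiag] at this
    have h3 : ∑ i, w i k * p i = 0 := by exact_mod_cast this
    exact (Finset.sum_eq_zero_iff_of_nonneg
      (fun i _ => mul_nonneg (hw0 i k) (hp0 i))).mp h3 i (Finset.mem_univ _)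
  have hps : ∑ i, p i = ∑ k, t k := by
    have := hσ.1.trace_eq_sum_eigenvalues
    rw [← hsum] at this
    have h4 := congrArg Complex.re this
    rw [Complex.ofReal_re] at h4
    rw [h4]
    simp [hp]
  have hS : vNEntropy σ = -∑ i, p i * Real.log (p i) := by
    rw [vNEntropy, dif_pos hσ.1, ← Finset.sum_neg_distrib]
    refine Finset.sum_congr rfl fun i _ => ?_
    rw [Real.negMulLog]; ring
  have total : ∑ i, ∑ k, w i k * (p i * Real.log (p i) - p i * Real.log (t k) - p i + t k)
      = -∑ k, ((Wᴴ * σ * W) k k).re * Real.log (t k) - vNEntropy σ := by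
    have e1 : ∑ i, ∑ k, w i k * (p i * Real.log (p i)) = ∑ i, p i * Real.log (p i) := by
      refine Finset.sum_congr rfl fun i _ => ?_
      rw [← Finset.sum_mul, row, one_mul]
    have e2 : ∑ i, ∑ k, w i k * (p i * Real.log (t k))
        = ∑ k, ((Wᴴ * σ * W) k k).re * Real.log (t k) := by
      rw [Finset.sum_comm]
      refine Finset.sum_congr rfl fun k _ => ?_
      rw [hdiag', Finset.sum_mul]
      refine Finset.sum_congr rfl fun i _ => ?_
      ring
    have e3 : ∑ i, ∑ k, w i k * p i = ∑ i, p i := by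
      refine Finset.sum_congr rfl fun i _ => ?_
      rw [← Finset.sum_mul, row, one_mul]
    have e4 : ∑ i, ∑ k, w i k * t k = ∑ i, t i := by
      rw [Finset.sum_comm]
      refine Finset.sum_congr rfl fun i _ => ?_
      rw [← Finset.sum_mul, col, one_mul]
    simp only [mul_add, mul_sub, Finset.sum_add_distrib, Finset.sum_sub_distrib]
    rw [e1, e2, e3, e4, hS, hps]; ring
  have tn := fun i k => term_nonneg (hp0 i) (ht k) (hw0 i k) (hterm i k)
  constructor
  · have : 0 ≤ ∑ i, ∑ k, w i k * (p i * Real.log (p i) - p i * Real.log (t k) - p i + t k) :=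
      Finset.sum_nonneg fun i _ => Finset.sum_nonneg fun k _ => (tn i k).1
    linarith
  · intro heq
    have hz : ∑ i, ∑ k, w i k * (p i * Real.log (p i) - p i * Real.log (t k) - p i + t k) = 0 := by
      rw [total]; linarith
    have hall : ∀ i k, w i k = 0 ∨ p i = t k := by
      intro i k
      apply (tn i k).2
      have h1 := (Finset.sum_eq_zero_iff_of_nonneg
        (fun i _ => Finset.sum_nonneg fun k _ => (tn i k).1)).mp hz i (Finset.mem_univ _)
      exact (Finset.sum_eq_zero_iff_of_nonneg
        (fun k _ => (tn i k).1)).mp h1 k (Finset.mem_univ _)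
    have hcomm : Matrix.diagonal (fun i => (p i : ℂ)) * G
        = G * Matrix.diagonal (fun k => (t k : ℂ)) := by
      ext i k
      rw [Matrix.diagonal_mul, Matrix.mul_diagonal]
      rcases hall i k with h | h
      · have : G i k = 0 := Complex.normSq_eq_zero.mp h
        simp [this]
      · rw [h, mul_comm]
    calc σ = U * Matrix.diagonal (fun i => (p i : ℂ)) * (G * Gᴴ) * Uᴴ := by
            rw [hG2, Matrix.mul_one]; exact hsp
      _ = U * (Matrix.diagonal (fun i => (p i : ℂ)) * G) * (Gᴴ * Uᴴ) := by
            simp only [Matrix.mul_assoc]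
      _ = (U * G) * Matrix.diagonal (fun k => (t k : ℂ)) * (U * G)ᴴ := by
            rw [hcomm, conjTranspose_mul U G]; simp only [Matrix.mul_assoc]
      _ = _ := by rw [hUG]

/-- Partial trace over the first factor. -/
noncomputable def trA {A B : Type*} [Fintype A] (σ : Matrix (A × B) (A × B) ℂ) : Matrix B B ℂ :=
  ∑ a, σ.submatrix (fun b => (a, b)) (fun b => (a, b))

lemma trA_apply {A B : Type*} [Fintype A] (σ : Matrix (A × B) (A × B) ℂ) (b b' : B) :
    trA σ b b' = ∑ a, σ (a, b) (a, b') := by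
  simp [trA, Matrix.sum_apply]

lemma trA_posSemidef {A B : Type*} [Fintype A] {σ : Matrix (A × B) (A × B) ℂ}
    (hσ : σ.PosSemidef) : (trA σ).PosSemidef :=
  Matrix.posSemidef_sum _ fun _ _ => hσ.submatrix _

lemma trA_trace {A B : Type*} [Fintype A] [Fintype B] (σ : Matrix (A × B) (A × B) ℂ) :
    (trA σ).trace = σ.trace := by
  simp only [Matrix.trace, Matrix.diag_apply, trA_apply, Fintype.sum_prod_type]
  exact Finset.sum_comm

lemma subadd {A B : Type*} [Fintype A] [Fintype B] [DecidableEq A] [DecidableEq B]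
    {σ : Matrix (A × B) (A × B) ℂ} (hσ : σ.PosSemidef) (htr : σ.trace = 1) :
    vNEntropy σ ≤ vNEntropy (trA σ) + Real.log (Fintype.card A) ∧
    (vNEntropy σ = vNEntropy (trA σ) + Real.log (Fintype.card A) →
      ∀ a b a' b', σ (a, b) (a', b') =
        if a = a' then (Fintype.card A : ℂ)⁻¹ * trA σ b b' else 0) := by
  have hτ := trA_posSemidef hσ
  have htrτ : (trA σ).trace = 1 := by rw [trA_trace, htr]
  have hA : Nonempty A := by
    by_contra h
    rw [not_nonempty_iff] at h
    simp [Matrix.trace] at htr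
  have hd : (0 : ℝ) < Fintype.card A := by exact_mod_cast Fintype.card_pos
  set d : ℝ := ((Fintype.card A : ℕ) : ℝ) with hdd
  have hdC : (Fintype.card A : ℂ) = (d : ℂ) := by rw [hdd]; simp
  set q := hτ.1.eigenvalues with hq
  have hq0 : ∀ b, 0 ≤ q b := fun b => hτ.eigenvalues_nonneg b
  obtain ⟨V, hV1, hV2, hsp⟩ : ∃ U : Matrix B B ℂ, Uᴴ * U = 1 ∧ U * Uᴴ = 1 ∧
      trA σ = U * Matrix.diagonal (fun i => (q i : ℂ)) * Uᴴ := by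
    refine ⟨hτ.1.eigenvectorUnitary, ?_, ?_, ?_⟩
    · exact Unitary.coe_star_mul_self hτ.1.eigenvectorUnitary
    · exact Unitary.coe_mul_star_self hτ.1.eigenvectorUnitary
    · conv_lhs => rw [hτ.1.spectral_theorem, Unitary.conjStarAlgAut_apply]
      rfl
  have hsp' : Vᴴ * trA σ * V = Matrix.diagonal (fun i => (q i : ℂ)) := by
    rw [hsp]
    calc Vᴴ * (V * Matrix.diagonal (fun i => (q i : ℂ)) * Vᴴ) * V
        = (Vᴴ * V) * Matrix.diagonal (fun i => (q i : ℂ)) * (Vᴴ * V) := by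
          simp only [Matrix.mul_assoc]
      _ = _ := by rw [hV1, Matrix.one_mul, Matrix.mul_one]
  set W : Matrix (A × B) (A × B) ℂ :=
    Matrix.of fun x y => if x.1 = y.1 then V x.2 y.2 else 0 with hWdef
  have hW : Wᴴ * W = 1 := by
    ext ⟨a, b⟩ ⟨a', b'⟩
    have := congrFun (congrFun hV1 b) b'
    rw [Matrix.mul_apply] at this
    rw [Matrix.mul_apply, Fintype.sum_prod_type, Finset.sum_comm]
    simp only [hWdef, conjTranspose_apply, Matrix.of_apply, Matrix.one_apply, Prod.mk.injEq,
      apply_ite star, star_zero, ite_mul, zero_mul, mul_ite, mul_zero] at this ⊢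
    by_cases haa : a = a'
    · subst haa
      simpa using this
    · simp [haa, Ne.symm haa]
  have hblock : ∀ a b, (Wᴴ * σ * W) (a, b) (a, b)
      = (Vᴴ * σ.submatrix (fun b => (a, b)) (fun b => (a, b)) * V) b b := by
    intro a b
    simp only [Matrix.mul_apply, Fintype.sum_prod_type, hWdef, conjTranspose_apply,
      Matrix.of_apply, Matrix.submatrix_apply, apply_ite star, star_zero, ite_mul, zero_mul,
      mul_ite, mul_zero]
    rw [Finset.sum_comm]
    refine Finset.sum_congr rfl fun x _ => ?_
    simp only [Finset.sum_ite_eq', Finset.mem_univ, if_true]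
    congr 1
    rw [Finset.sum_comm]
    simp
  have hblocksum : ∀ b, ∑ a, (Wᴴ * σ * W) (a, b) (a, b) = (q b : ℂ) := by
    intro b
    have := congrFun (congrFun hsp' b) b
    rw [Matrix.diagonal_apply_eq] at this
    rw [← this, trA, Matrix.mul_sum, Matrix.sum_mul, Matrix.sum_apply]
    exact Finset.sum_congr rfl fun a _ => hblock a b
  have hnn : ∀ x, 0 ≤ (Wᴴ * σ * W) x x := fun x =>
    (hσ.conjTranspose_mul_mul_same W).diag_nonneg
  have hqs : ∑ b, q b = 1 := by
    have := hτ.1.trace_eq_sum_eigenvalues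
    rw [htrτ] at this
    have h4 := congrArg Complex.re this
    simp at h4
    exact h4.symm
  have K := klein hσ W hW (fun x => q x.2 / d) (fun x => div_nonneg (hq0 _) hd.le) (by
      rw [htr, Fintype.sum_prod_type]
      simp only [← Finset.sum_div, hqs, Finset.sum_const, Finset.card_univ, nsmul_eq_mul]
      rw [← hdd]; rw [mul_one, div_self hd.ne']; simp) (by
      rintro ⟨a, b⟩ h
      have hb : q b = 0 := by
        simpa [hd.ne'] using h
      have := hblocksum b
      rw [hb, Complex.ofReal_zero] at this
      exact (Finset.sum_eq_zero_iff_of_nonneg (fun a _ => hnn (a, b))).mp this a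
        (Finset.mem_univ _))
  have hval : -∑ x : A × B, ((Wᴴ * σ * W) x x).re * Real.log (q x.2 / d)
      = vNEntropy (trA σ) + Real.log d := by
    rw [Fintype.sum_prod_type, Finset.sum_comm]
    have : ∀ b, ∑ a, ((Wᴴ * σ * W) (a, b) (a, b)).re * Real.log (q b / d)
        = -Real.negMulLog (q b) - q b * Real.log d := by
      intro b
      have h5 := congrArg Complex.re (hblocksum b)
      rw [Complex.re_sum, Complex.ofReal_re] at h5
      rw [← Finset.sum_mul, h5, Real.negMulLog]
      rcases (hq0 b).eq_or_lt with h | h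
      · simp [← h]
      · rw [Real.log_div h.ne' hd.ne']; ring
    simp only [this, Finset.sum_sub_distrib, Finset.sum_neg_distrib, ← Finset.sum_mul, hqs]
    rw [vNEntropy, dif_pos hτ.1]
    ring
  rw [hval] at K
  refine ⟨K.1, fun h a b a' b' => ?_⟩
  have h6 := congrFun (congrFun (K.2 h) (a, b)) (a', b')
  rw [h6, Matrix.mul_apply, Fintype.sum_prod_type, Finset.sum_comm]
  simp only [Matrix.mul_diagonal, hWdef, conjTranspose_apply,
      Matrix.of_apply, apply_ite star, star_zero, ite_mul, zero_mul,
      mul_ite, mul_zero]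
  by_cases haa : a = a'
  · subst haa
    simp only [if_true, Finset.sum_ite_eq, Finset.mem_univ]
    rw [hsp, Matrix.mul_apply, Finset.mul_sum]
    refine Finset.sum_congr rfl fun x _ => ?_
    rw [Matrix.mul_diagonal, conjTranspose_apply, hdC]
    push_cast
    ring
  · rw [if_neg haa]
    refine Finset.sum_eq_zero fun x _ => Finset.sum_eq_zero fun y _ => ?_
    split_ifs with h1 h2
    · exact absurd (h2.trans h1.symm) haa
    all_goals rfl

lemma arakiLieb {A B : Type*} [Fintype A] [Fintype B] [DecidableEq A] [DecidableEq B]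
    {σ : Matrix (A × B) (A × B) ℂ} (hσ : σ.PosSemidef) (htr : σ.trace = 1) :
    vNEntropy (trA σ) ≤ vNEntropy σ + Real.log (Fintype.card A) := by
  obtain ⟨m, v, hv⟩ := Matrix.posSemidef_iff_eq_sum_vecMulVec.mp hσ
  set M : Matrix (A × B) (Fin m) ℂ := Matrix.of fun x c => v c x with hM
  set X : Matrix B (A × Fin m) ℂ := Matrix.of fun b y => v y.2 (y.1, b) with hX
  have h1 : σ = M * Mᴴ := by
    rw [hv]; ext x y
    simp [Matrix.sum_apply, Matrix.mul_apply, Matrix.vecMulVec_apply, hM]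
  have h2 : trA σ = X * Xᴴ := by
    ext b b'
    rw [trA_apply, h1]
    simp [Matrix.mul_apply, hM, hX, Fintype.sum_prod_type]
  have h3 : trA (Xᴴ * X) = Mᴴ * M := by
    ext c c'
    rw [trA_apply]
    simp [Matrix.mul_apply, hM, hX, Fintype.sum_prod_type]
  have h4 : (Xᴴ * X).trace = 1 := by
    rw [Matrix.trace_mul_comm, ← h2, trA_trace, htr]
  have := (subadd (Matrix.posSemidef_conjTranspose_mul_self X) h4).1
  rwa [h3, ← vN_mul_comm, ← vN_mul_comm, ← h1, ← h2] at this

/-- Split off party `i`. -/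
def e0 {N d : ℕ} (i : Fin N) :
    (Fin N → Fin d) ≃ Fin d × ({k : Fin N // k ∉ ({i} : Finset (Fin N))} → Fin d) where
  toFun f := (f i, fun k => f k)
  invFun x := fun k => if h : k ∈ ({i} : Finset (Fin N)) then x.1 else x.2 ⟨k, h⟩
  left_inv f := by
    funext k
    by_cases h : k = i
    · subst h; simp
    · simp [h]
  right_inv x := by
    ext1
    · simp
    · funext k
      simp [k.2]

/-- Split off party `j` after party `i` has been removed. -/
def e1 {N d : ℕ} (i j : Fin N) (hij : i ≠ j) :
    ({k : Fin N // k ∉ ({i} : Finset (Fin N))} → Fin d) ≃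
      Fin d × ({k : Fin N // k ∉ ({i, j} : Finset (Fin N))} → Fin d) where
  toFun f := (f ⟨j, by simpa using hij.symm⟩,
    fun k => f ⟨k.1, fun h => k.2 (by simp at h; simp [h])⟩)
  invFun x := fun k => if h : k.1 = j then x.1 else
    x.2 ⟨k.1, by have := k.2; simp at this ⊢; exact ⟨this, h⟩⟩
  left_inv f := by
    funext k
    by_cases h : k.1 = j
    · obtain ⟨k, hk⟩ := k; simp only at h; subst h; simp
    · simp [h]
  right_inv x := by
    ext1
    · simp
    · funext k
      have : k.1 ≠ j := fun h => k.2 (by simp [h])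
      simp [this]

lemma trA_e0 {N d : ℕ} (i : Fin N) (ρ : Matrix (Fin N → Fin d) (Fin N → Fin d) ℂ) :
    trA (ρ.submatrix (e0 i).symm (e0 i).symm) = ptrace {i} ρ := by
  ext a b
  rw [trA_apply, ptrace, Matrix.of_apply]
  have : Unique {k : Fin N // k ∈ ({i} : Finset (Fin N))} :=
    ⟨⟨⟨i, by simp⟩⟩, fun x => Subtype.ext (Finset.mem_singleton.mp x.2)⟩
  refine (Equiv.sum_comp (Equiv.funUnique {k : Fin N // k ∈ ({i} : Finset (Fin N))} (Fin d)) _).symm.trans ?_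
  refine Finset.sum_congr rfl fun c _ => ?_
  have key : ∀ a, (e0 i).symm ((Equiv.funUnique {k : Fin N // k ∈ ({i} : Finset (Fin N))} (Fin d)) c, a)
      = mergeOn {i} a c := by
    intro a
    funext k
    simp only [e0, mergeOn, Equiv.coe_fn_symm_mk]
    split_ifs with h
    · rw [Equiv.funUnique_apply]
      exact congrArg c (Subsingleton.elim _ _)
    · rfl
  rw [Matrix.submatrix_apply, key, key]

/-- Configurations on a pair. -/
def pairE {N d : ℕ} (i j : Fin N) (hij : i ≠ j) :
    ({k : Fin N // k ∈ ({i, j} : Finset (Fin N))} → Fin d) ≃ Fin d × Fin d where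
  toFun c := (c ⟨j, by simp⟩, c ⟨i, by simp⟩)
  invFun x := fun k => if k.1 = j then x.1 else x.2
  left_inv c := by
    funext ⟨k, hk⟩
    have hk' := hk
    simp at hk'
    rcases hk' with h | h
    · subst h; simp [hij]
    · subst h; simp
  right_inv x := by simp [hij]

lemma trA_e1 {N d : ℕ} (i j : Fin N) (hij : i ≠ j)
    (ρ : Matrix (Fin N → Fin d) (Fin N → Fin d) ℂ) :
    trA ((ptrace {i} ρ).submatrix (e1 i j hij).symm (e1 i j hij).symm) = ptrace {i, j} ρ := by
  ext a b
  rw [trA_apply, ptrace, ptrace, Matrix.of_apply]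
  simp only [Matrix.submatrix_apply]
  have : ∀ x y, (Matrix.of fun a b => ∑ c, ρ (mergeOn {i} a c) (mergeOn {i} b c)) x y
      = ∑ z, ρ ((e0 i).symm (z, x)) ((e0 i).symm (z, y)) := by
    intro x y
    have := congrFun (congrFun (trA_e0 i ρ) x) y
    rw [trA_apply] at this
    exact this.symm
  simp only [this]
  rw [← Fintype.sum_prod_type' (f := fun x z => ρ ((e0 i).symm (z, (e1 i j hij).symm (x, a)))
    ((e0 i).symm (z, (e1 i j hij).symm (x, b))))]
  refine (Equiv.sum_comp (pairE i j hij) _).symm.trans ?_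
  refine Finset.sum_congr rfl fun c _ => ?_
  have key : ∀ a, (e0 i).symm ((pairE i j hij c).2, (e1 i j hij).symm ((pairE i j hij c).1, a))
      = mergeOn {i, j} a c := by
    intro a
    funext k
    simp only [e0, e1, pairE, mergeOn, Equiv.coe_fn_symm_mk, Equiv.coe_fn_mk]
    by_cases h1 : k = i
    · subst h1; simp
    · by_cases h2 : k = j
      · subst h2; simp [h1]
      · simp [h1, h2]
  rw [key, key]

lemma const_of_update {ι : Type*} [Fintype ι] [DecidableEq ι] {α β : Type*}
    (F : (ι → α) → β) (h : ∀ f j x, F (Function.update f j x) = F f) (f g : ι → α) :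
    F f = F g := by
  have : ∀ s : Finset ι, F (s.piecewise f g) = F g := by
    intro s
    induction s using Finset.induction_on with
    | empty => simp
    | insert a s ha ih => rw [Finset.piecewise_insert, h, ih]
  simpa using this Finset.univ

end DepAux

open DepAux

/-- if an `N`-partite density matrix `ρ` of local dimension `d`
(`N ≥ 3`) attains the maximal quantum value of the dependence,
`D_N(ρ) = 2 log d`, then `ρ` is `(N−1)`-uniform: the marginal on any `N−1`
parties (partial trace over any single party) is maximally mixed. -/
theorem stmt_15 {N d : ℕ} (hN : 3 ≤ N)
    (ρ : Matrix (Fin N → Fin d) (Fin N → Fin d) ℂ)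
    (hρ : ρ.PosSemidef) (htr : ρ.trace = 1)
    (hdep : depQ ρ = 2 * Real.log d) :
    ∀ i : Fin N, ptrace {i} ρ = (((d : ℂ) ^ (N - 1))⁻¹) • 1 := by
  have hpair : ∀ i j : Fin N, i ≠ j → 2 * Real.log d ≤
      vNEntropy (ptrace {i} ρ) + vNEntropy (ptrace {j} ρ)
        - vNEntropy (ptrace {i, j} ρ) - vNEntropy ρ := by
    intro i j hij
    rw [← hdep]
    refine csInf_le ?_ ⟨i, j, hij, rfl⟩
    apply Set.Finite.bddBelow
    refine (Set.finite_range (fun x : Fin N × Fin N => vNEntropy (ptrace {x.1} ρ)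
      + vNEntropy (ptrace {x.2} ρ) - vNEntropy (ptrace {x.1, x.2} ρ) - vNEntropy ρ)).subset ?_
    rintro x ⟨i, j, _, rfl⟩
    exact ⟨(i, j), rfl⟩
  have hsub0 : ∀ i, (ρ.submatrix (e0 i).symm (e0 i).symm).PosSemidef := fun i => hρ.submatrix _
  have htr0 : ∀ i, (ρ.submatrix (e0 i).symm (e0 i).symm).trace = 1 := by
    intro i
    rw [← htr]
    exact Equiv.sum_comp (e0 i).symm (fun x => ρ x x)
  have hpt : ∀ i, (ptrace {i} ρ).PosSemidef := fun i => by
    rw [← trA_e0]; exact trA_posSemidef (hsub0 i)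
  have htrp : ∀ i, (ptrace {i} ρ).trace = 1 := fun i => by
    rw [← trA_e0, trA_trace, htr0]
  have hstr : ∀ i j (hij : i ≠ j), ∀ a b a' b',
      (ptrace {i} ρ) ((e1 i j hij).symm (a, b)) ((e1 i j hij).symm (a', b')) =
        if a = a' then (d : ℂ)⁻¹ * ptrace {i, j} ρ b b' else 0 := by
    intro i j hij
    have h1 := arakiLieb (hsub0 j) (htr0 j)
    rw [trA_e0, vN_reindex _ hρ.1, Fintype.card_fin] at h1
    have htr1 : ((ptrace {i} ρ).submatrix (e1 i j hij).symm (e1 i j hij).symm).trace = 1 := by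
      rw [← htrp i]
      exact Equiv.sum_comp (e1 i j hij).symm (fun x => ptrace {i} ρ x x)
    have h2 := subadd ((hpt i).submatrix (e1 i j hij).symm) htr1
    rw [trA_e1, vN_reindex _ (hpt i).1, Fintype.card_fin] at h2
    have h3 := hpair i j hij
    exact h2.2 (by linarith [h2.1])
  intro i
  have hoff : ∀ f g, f ≠ g → ptrace {i} ρ f g = 0 := by
    intro f g hfg
    obtain ⟨⟨j, hj⟩, hne⟩ := Function.ne_iff.mp hfg
    have hij : i ≠ j := by simp at hj; exact Ne.symm hj
    have := hstr i j hij (e1 i j hij f).1 (e1 i j hij f).2 (e1 i j hij g).1 (e1 i j hij g).2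
    rw [Prod.mk.eta, Prod.mk.eta, Equiv.symm_apply_apply, Equiv.symm_apply_apply,
      if_neg (by exact hne)] at this
    exact this
  have hconst : ∀ f g, ptrace {i} ρ f f = ptrace {i} ρ g g := by
    intro f g
    refine const_of_update (fun f => ptrace {i} ρ f f) ?_ f g
    rintro f ⟨j, hj⟩ x
    have hij : i ≠ j := by simp at hj; exact Ne.symm hj
    have H : ∀ f, ptrace {i} ρ f f = (d : ℂ)⁻¹ * ptrace {i, j} ρ (e1 i j hij f).2 (e1 i j hij f).2 := by
      intro f
      have := hstr i j hij (e1 i j hij f).1 (e1 i j hij f).2 (e1 i j hij f).1 (e1 i j hij f).2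
      rwa [Prod.mk.eta, Equiv.symm_apply_apply, if_pos rfl] at this
    rw [H, H f]
    have : (e1 i j hij (Function.update f ⟨j, hj⟩ x)).2 = (e1 i j hij f).2 := by
      funext k
      have hk : k.1 ≠ j := fun h => k.2 (by simp [h])
      simp [e1, Function.update, hk]
    rw [this]
  have hcard : Fintype.card ({k : Fin N // k ∉ ({i} : Finset (Fin N))} → Fin d) = d ^ (N - 1) := by
    simp [Fintype.card_subtype_compl]
  ext f g
  by_cases hfg : f = g
  · subst hfg
    have h1 := htrp i
    rw [Matrix.trace] at h1
    simp only [Matrix.diag_apply] at h1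
    rw [Finset.sum_congr rfl (fun g _ => hconst g f), Finset.sum_const, Finset.card_univ, hcard,
      nsmul_eq_mul] at h1
    push_cast at h1
    rw [Matrix.smul_apply, Matrix.one_apply_eq, smul_eq_mul, mul_one]
    exact eq_inv_of_mul_eq_one_right h1
  · rw [hoff f g hfg]
    simp [hfg]
end

section
/- Let 0 < e < N with N ≥ 3, and let ρ = |D_N^e⟩⟨D_N^e| be the N-qubit Dicke state with e excitations. Then the N-partite dependence equals D_N(ρ) = 2 h(e/N) − [ −λ_1 log λ_1 − λ_2 log λ_2 − λ_3 log λ_3 ], where h(p) = −p log p − (1−p) log(1−p) is the binary entropy, λ_1 = e(e−1)/(N(N−1)), λ_2 = 2e(N−e)/(N(N−1)), λ_3 = (N−e)(N−e−1)/(N(N−1)), all logarithms are natural, and 0 log 0 = 0. -/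
open Matrix ComplexOrder

/-- The `N`-qubit Dicke state vector with `e` excitations: entry
`C(N,e)^{−1/2}` at every bit string of Hamming weight `e` and `0` elsewhere. -/
noncomputable def dickeVec (N e : ℕ) : (Fin N → Fin 2) → ℂ :=
  fun x => if (∑ i, (x i : ℕ)) = e
    then ((1 / Real.sqrt (N.choose e) : ℝ) : ℂ) else 0

/-- The density matrix `|D_N^e⟩⟨D_N^e|` of the `N`-qubit Dicke state with `e`
excitations. -/
noncomputable def dickeMat (N e : ℕ) : Matrix (Fin N → Fin 2) (Fin N → Fin 2) ℂ :=
  Matrix.of fun x y => dickeVec N e x * star (dickeVec N e y)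

/-- Binary entropy `h(p) = −p log p − (1−p) log (1−p)` (natural logarithm,
`0 log 0 = 0`). -/
noncomputable def binEnt (p : ℝ) : ℝ := Real.negMulLog p + Real.negMulLog (1 - p)


lemma entropy_of_factor {n K : Type*} [Fintype n] [DecidableEq n] [Fintype K] [DecidableEq K]
    (M : Matrix n n ℂ) (hM : M.IsHermitian) (A : Matrix n K ℂ) (B : Matrix K n ℂ) (l : K → ℝ)
    (hAB : M = A * B) (hBA : B * A = Matrix.diagonal fun k => (l k : ℂ)) :
    vNEntropy M = ∑ k, Real.negMulLog (l k) := by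
  have h1 := Matrix.charpoly_mul_comm' A B
  rw [← hAB, hBA, Matrix.charpoly_diagonal] at h1
  have h2 := congrArg (fun p : Polynomial ℂ =>
    (p.roots.map fun z => Real.negMulLog z.re).sum) h1
  have hp : (∏ k, (Polynomial.X - Polynomial.C (l k : ℂ))) ≠ 0 := by
    simp [Finset.prod_ne_zero_iff, Polynomial.X_sub_C_ne_zero]
  have hX : ∀ m : ℕ, (Polynomial.X ^ m : Polynomial ℂ) ≠ 0 := fun m =>
    pow_ne_zero _ Polynomial.X_ne_zero
  rw [Polynomial.roots_mul (mul_ne_zero (hX _) (M.charpoly_monic.ne_zero)),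
    Polynomial.roots_mul (mul_ne_zero (hX _) hp), Polynomial.roots_prod _ _ hp,
    hM.roots_charpoly_eq_eigenvalues] at h2
  simp [Multiset.map_nsmul, Multiset.sum_nsmul] at h2
  rw [vNEntropy, dif_pos hM]
  exact h2

lemma card_weight {ι : Type*} [Fintype ι] [DecidableEq ι] (m : ℕ) :
    (Finset.univ.filter fun x : ι → Fin 2 => ∑ i, (x i : ℕ) = m).card
      = (Fintype.card ι).choose m := by
  rw [← Finset.card_univ, ← Finset.card_powersetCard]
  have key : ∀ x : ι → Fin 2, (Finset.univ.filter fun i => x i = 1).card = ∑ i, (x i : ℕ) := by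
    intro x
    rw [Finset.card_filter]
    refine Finset.sum_congr rfl fun i _ => ?_
    generalize x i = y
    fin_cases y <;> rfl
  refine Finset.card_bij' (fun x _ => Finset.univ.filter fun i => x i = 1)
    (fun s _ i => if i ∈ s then 1 else 0) ?_ ?_ ?_ ?_
  · intro x hx
    simp only [Finset.mem_filter, Finset.mem_univ, true_and] at hx
    simp [Finset.mem_powersetCard, key, hx]
  · intro s hs
    rw [Finset.mem_powersetCard] at hs
    simp only [Finset.mem_filter, Finset.mem_univ, true_and]
    rw [← key]
    simp [hs.2]
  · intro x hx
    funext i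
    simp only [Finset.mem_filter, Finset.mem_univ, true_and]
    generalize x i = y
    fin_cases y <;> rfl
  · intro s hs
    ext i
    simp

/-- Number of strings of length `n` with weight `e - k` (zero if `k > e`). -/
def cntW (n e k : ℕ) : ℕ := if k ≤ e then n.choose (e - k) else 0

lemma card_weight_add {ι : Type*} [Fintype ι] [DecidableEq ι] (e k : ℕ) :
    (Finset.univ.filter fun x : ι → Fin 2 => ∑ i, (x i : ℕ) + k = e).card
      = cntW (Fintype.card ι) e k := by
  unfold cntW
  split_ifs with h
  · rw [← card_weight]
    congr 1
    ext x
    simp only [Finset.mem_filter, Finset.mem_univ, true_and]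
    omega
  · rw [Finset.card_eq_zero, Finset.filter_eq_empty_iff]
    intro x _
    omega

lemma entropy_weight {ι : Type*} [Fintype ι] [DecidableEq ι] (e t : ℕ) (w : ℕ → ℝ)
    (M : Matrix (ι → Fin 2) (ι → Fin 2) ℂ)
    (hM : ∀ a b, M a b = ∑ k : Fin t, (w k : ℂ) *
      ((if ∑ i, (a i : ℕ) + k = e then 1 else 0) * (if ∑ i, (b i : ℕ) + k = e then 1 else 0))) :
    vNEntropy M = ∑ k : Fin t, Real.negMulLog (w k * cntW (Fintype.card ι) e k) := by
  refine entropy_of_factor (K := Fin t) M ?_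
    (Matrix.of fun a (k : Fin t) => if ∑ i, (a i : ℕ) + k = e then 1 else 0)
    (Matrix.of fun (k : Fin t) b => (w k : ℂ) * if ∑ i, (b i : ℕ) + k = e then 1 else 0) _ ?_ ?_
  · ext a b
    rw [Matrix.conjTranspose_apply, hM, hM]
    simp only [star_sum, star_mul', apply_ite (star : ℂ → ℂ), star_one, star_zero]
    refine Finset.sum_congr rfl fun k _ => ?_
    rw [mul_comm (ite _ _ _) (ite _ _ _)]
    congr 1
    exact Complex.conj_ofReal _
  · ext a b
    rw [hM, Matrix.mul_apply]
    refine Finset.sum_congr rfl fun k _ => ?_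
    simp only [Matrix.of_apply]
    ring
  · ext k k'
    rw [Matrix.mul_apply, Matrix.diagonal_apply]
    simp only [Matrix.of_apply]
    split_ifs with h
    · subst h
      rw [← card_weight_add (ι := ι), Finset.card_filter]
      push_cast
      rw [Finset.mul_sum]
      refine Finset.sum_congr rfl fun x _ => ?_
      split_ifs <;> simp
    · refine Finset.sum_eq_zero fun x _ => ?_
      have : (k : ℕ) ≠ k' := fun h' => h (Fin.ext h')
      split_ifs
      · omega
      all_goals simp

lemma dickeMat_apply (N e : ℕ) (x y : Fin N → Fin 2) :
    dickeMat N e x y = ((1 / (N.choose e : ℝ) : ℝ) : ℂ) *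
      ((if ∑ i, (x i : ℕ) = e then 1 else 0) * (if ∑ i, (y i : ℕ) = e then 1 else 0)) := by
  have h : (1 / Real.sqrt (N.choose e)) * (1 / Real.sqrt (N.choose e)) = 1 / (N.choose e : ℝ) := by
    rw [div_mul_div_comm, Real.mul_self_sqrt (Nat.cast_nonneg _), one_mul]
  have h2 : (((1 / Real.sqrt (N.choose e) : ℝ) : ℂ)) * star (((1 / Real.sqrt (N.choose e) : ℝ) : ℂ))
      = ((1 / (N.choose e : ℝ) : ℝ) : ℂ) := by
    rw [← h, Complex.ofReal_mul]
    congr 1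
    exact Complex.conj_ofReal _
  simp only [dickeMat, dickeVec, Matrix.of_apply]
  split_ifs
  · rw [h2]; simp
  all_goals simp

lemma sum_mergeOn {N : ℕ} (T : Finset (Fin N)) (a : {i : Fin N // i ∉ T} → Fin 2)
    (c : {i : Fin N // i ∈ T} → Fin 2) :
    ∑ i, (mergeOn T a c i : ℕ) = ∑ i, (a i : ℕ) + ∑ i, (c i : ℕ) := by
  rw [← Fintype.sum_subtype_add_sum_subtype (fun i => i ∈ T), add_comm]
  congr 1
  · refine Finset.sum_congr rfl fun i _ => ?_
    simp [mergeOn, i.2]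
  · refine Finset.sum_congr (by ext; simp) fun i _ => ?_
    simp [mergeOn, i.2]

lemma weight_le {ι : Type*} [Fintype ι] (c : ι → Fin 2) :
    ∑ i, (c i : ℕ) ≤ Fintype.card ι := by
  rw [← Finset.card_univ, Finset.card_eq_sum_ones]
  exact Finset.sum_le_sum fun i _ => by omega

lemma sum_by_weight {ι : Type*} [Fintype ι] [DecidableEq ι] (f : ℕ → ℂ) :
    ∑ c : ι → Fin 2, f (∑ i, (c i : ℕ))
      = ∑ k : Fin (Fintype.card ι + 1), ((Fintype.card ι).choose k : ℂ) * f k := by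
  rw [Fin.sum_univ_eq_sum_range (fun k => ((Fintype.card ι).choose k : ℂ) * f k)]
  rw [← Finset.sum_fiberwise_of_maps_to (s := Finset.univ)
    (t := Finset.range (Fintype.card ι + 1)) (g := fun c : ι → Fin 2 => ∑ i, (c i : ℕ))
    (fun c _ => Finset.mem_range.2 (Nat.lt_succ_of_le (weight_le c)))]
  refine Finset.sum_congr rfl fun k _ => ?_
  rw [← card_weight, ← nsmul_eq_mul, ← Finset.sum_const]
  refine Finset.sum_congr rfl fun c hc => ?_
  rw [(Finset.mem_filter.1 hc).2]

lemma entropy_ptrace {N e : ℕ} (T : Finset (Fin N)) :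
    vNEntropy (ptrace T (dickeMat N e)) = ∑ k : Fin (T.card + 1),
      Real.negMulLog ((1 / (N.choose e : ℝ) * (T.card).choose k) * cntW (N - T.card) e k) := by
  have hc : Fintype.card {i : Fin N // i ∉ T} = N - T.card := by
    simp [Fintype.card_subtype_compl]
  have ht : Fintype.card {i : Fin N // i ∈ T} = T.card := by simp
  rw [← hc]
  refine entropy_weight e _ (fun k => 1 / (N.choose e : ℝ) * (T.card).choose k) _ ?_
  intro a b
  simp only [ptrace, Matrix.of_apply, dickeMat_apply, sum_mergeOn]
  rw [sum_by_weight (fun m => ((1 / (N.choose e : ℝ) : ℝ) : ℂ) *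
      ((if ∑ i, (a i : ℕ) + m = e then 1 else 0) * (if ∑ i, (b i : ℕ) + m = e then 1 else 0))), ht]
  refine Finset.sum_congr rfl fun k _ => ?_
  push_cast
  ring

lemma entropy_pure {N e : ℕ} (h : e ≤ N) : vNEntropy (dickeMat N e) = 0 := by
  rw [entropy_weight e 1 (fun _ => 1 / (N.choose e : ℝ)) _ (by
    intro a b
    simp only [dickeMat_apply]
    simp)]
  have : (N.choose e : ℝ) ≠ 0 := by exact_mod_cast (Nat.choose_pos h).ne'
  simp [cntW, this]

lemma entropy_one {N e : ℕ} (he : 0 < e) (heN : e < N) (i : Fin N) :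
    vNEntropy (ptrace {i} (dickeMat N e)) = binEnt ((e : ℝ) / N) := by
  rw [entropy_ptrace, Finset.card_singleton, Fin.sum_univ_two]
  obtain ⟨k, rfl⟩ : ∃ k, e = k + 1 := ⟨e - 1, by omega⟩
  obtain ⟨n, rfl⟩ : ∃ n, N = n + 1 := ⟨N - 1, by omega⟩
  have hpos : ((n + 1).choose (k + 1) : ℝ) ≠ 0 := by exact_mod_cast (Nat.choose_pos heN.le).ne'
  have h1 : ((n : ℝ) + 1) * n.choose k = (n + 1).choose (k + 1) * (k + 1) := by
    exact_mod_cast Nat.add_one_mul_choose_eq n k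
  have h2 : ((n + 1).choose (k + 1) : ℝ) = n.choose k + n.choose (k + 1) := by
    exact_mod_cast Nat.choose_succ_succ n k
  have hn : (n : ℝ) + 1 ≠ 0 := by positivity
  simp only [cntW, binEnt, Fin.val_zero, Fin.val_one, Nat.choose_self, Nat.choose_zero_right,
    Nat.add_sub_cancel, Nat.sub_zero, Nat.zero_le, if_true,
    Nat.succ_le_succ_iff, Nat.le_add_left]
  rw [add_comm]
  congr 2
  · push_cast
    field_simp
    linarith
  · push_cast
    field_simp
    linear_combination (-(n : ℝ) - 1) * h2 - h1

lemma entropy_two {N e : ℕ} (hN : 3 ≤ N) (he : 0 < e) (heN : e < N) (i j : Fin N) (hij : i ≠ j) :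
    vNEntropy (ptrace {i, j} (dickeMat N e)) =
      (Real.negMulLog ((e : ℝ) * ((e : ℝ) - 1) / ((N : ℝ) * ((N : ℝ) - 1)))
          + Real.negMulLog (2 * (e : ℝ) * ((N : ℝ) - e) / ((N : ℝ) * ((N : ℝ) - 1)))
          + Real.negMulLog
              (((N : ℝ) - e) * ((N : ℝ) - e - 1) / ((N : ℝ) * ((N : ℝ) - 1)))) := by
  rw [entropy_ptrace, Finset.card_pair hij, Fin.sum_univ_three]
  obtain ⟨k, rfl⟩ : ∃ k, e = k + 1 := ⟨e - 1, by omega⟩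
  obtain ⟨n, rfl⟩ : ∃ n, N = n + 2 := ⟨N - 2, by omega⟩
  have hpos : ((n + 2).choose (k + 1) : ℝ) ≠ 0 := by exact_mod_cast (Nat.choose_pos heN.le).ne'
  have h1 : ((n : ℝ) + 2) * (n + 1).choose k = (n + 2).choose (k + 1) * (k + 1) := by
    exact_mod_cast Nat.add_one_mul_choose_eq (n + 1) k
  have h2 : ((n + 2).choose (k + 1) : ℝ) = (n + 1).choose k + (n + 1).choose (k + 1) := by
    exact_mod_cast Nat.choose_succ_succ (n + 1) k
  have h3 : ((n : ℝ) + 1) * n.choose k = (n + 1).choose (k + 1) * (k + 1) := by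
    exact_mod_cast Nat.add_one_mul_choose_eq n k
  have h4 : ((n + 1).choose (k + 1) : ℝ) = n.choose k + n.choose (k + 1) := by
    exact_mod_cast Nat.choose_succ_succ n k
  have h5 : ((n : ℝ) + 1) * cntW n (k + 1) 2 = (n + 1).choose k * k := by
    cases k with
    | zero => simp [cntW]
    | succ k =>
      simp only [cntW]
      exact_mod_cast Nat.add_one_mul_choose_eq n k
  have hn1 : (n : ℝ) + 1 ≠ 0 := by positivity
  have hn2 : (n : ℝ) + 2 ≠ 0 := by positivity
  have c0 : cntW n (k + 1) 0 = n.choose (k + 1) := by simp [cntW]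
  have c1 : cntW n (k + 1) 1 = n.choose k := by simp [cntW]
  have e0 : ((0 : Fin (2 + 1)) : ℕ) = 0 := rfl
  have e1 : ((1 : Fin (2 + 1)) : ℕ) = 1 := rfl
  have e2 : ((2 : Fin (2 + 1)) : ℕ) = 2 := rfl
  have q : ((n : ℝ) + 2 - 1) = n + 1 := by ring
  rw [e0, e1, e2, Nat.add_sub_cancel, c0, c1]
  generalize (cntW n (k + 1) 2 : ℝ) = z at *
  have a3 : 1 / ((n + 2).choose (k + 1) : ℝ) * (Nat.choose 2 2 : ℕ) * z =
      ((k + 1 : ℕ) : ℝ) * (((k + 1 : ℕ) : ℝ) - 1) / (((n + 2 : ℕ) : ℝ) * (((n + 2 : ℕ) : ℝ) - 1)) := by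
    push_cast
    rw [q]
    simp only [Nat.choose_self, Nat.cast_one]
    field_simp
    linear_combination ((n : ℝ) + 2) * h5 + (k : ℝ) * h1
  have a2 : 1 / ((n + 2).choose (k + 1) : ℝ) * (Nat.choose 2 1 : ℕ) * (n.choose k : ℝ) =
      2 * ((k + 1 : ℕ) : ℝ) * (((n + 2 : ℕ) : ℝ) - ((k + 1 : ℕ) : ℝ)) / (((n + 2 : ℕ) : ℝ) * (((n + 2 : ℕ) : ℝ) - 1)) := by
    push_cast
    rw [q]
    simp only [Nat.choose_one_right, Nat.cast_ofNat]
    field_simp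
    linear_combination ((n : ℝ) + 2) * h3 - ((k : ℝ) + 1) * ((n + 2) * h2 + h1)
  have a1 : 1 / ((n + 2).choose (k + 1) : ℝ) * (Nat.choose 2 0 : ℕ) * (n.choose (k + 1) : ℝ) =
      (((n + 2 : ℕ) : ℝ) - ((k + 1 : ℕ) : ℝ)) * (((n + 2 : ℕ) : ℝ) - ((k + 1 : ℕ) : ℝ) - 1) / (((n + 2 : ℕ) : ℝ) * (((n + 2 : ℕ) : ℝ) - 1)) := by
    push_cast
    rw [q]
    simp only [Nat.choose_zero_right, Nat.cast_one]
    field_simp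
    linear_combination (-((n : ℝ) + 2) * (n + 1)) * h4 - ((n : ℝ) + 2) * h3 - ((n : ℝ) - k) * ((n + 2) * h2 + h1)
  rw [a1, a2, a3]
  ring

/-- the `N`-partite dependence of the `N`-qubit Dicke state with
`e` excitations (`0 < e < N`, `N ≥ 3`) equals
`2 h(e/N) − [−λ_1 log λ_1 − λ_2 log λ_2 − λ_3 log λ_3]` with
`λ_1 = e(e−1)/(N(N−1))`, `λ_2 = 2e(N−e)/(N(N−1))`, `λ_3 = (N−e)(N−e−1)/(N(N−1))`. -/
theorem stmt_17 {N e : ℕ} (hN : 3 ≤ N) (he : 0 < e) (heN : e < N) :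
    depQ (dickeMat N e)
      = 2 * binEnt ((e : ℝ) / N)
        - (Real.negMulLog ((e : ℝ) * ((e : ℝ) - 1) / ((N : ℝ) * ((N : ℝ) - 1)))
          + Real.negMulLog (2 * (e : ℝ) * ((N : ℝ) - e) / ((N : ℝ) * ((N : ℝ) - 1)))
          + Real.negMulLog
              (((N : ℝ) - e) * ((N : ℝ) - e - 1) / ((N : ℝ) * ((N : ℝ) - 1)))) := by
  have hset : {x | ∃ i j : Fin N, i ≠ j ∧
      x = vNEntropy (ptrace {i} (dickeMat N e)) + vNEntropy (ptrace {j} (dickeMat N e))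
        - vNEntropy (ptrace {i, j} (dickeMat N e)) - vNEntropy (dickeMat N e)} =
      {2 * binEnt ((e : ℝ) / N)
        - (Real.negMulLog ((e : ℝ) * ((e : ℝ) - 1) / ((N : ℝ) * ((N : ℝ) - 1)))
          + Real.negMulLog (2 * (e : ℝ) * ((N : ℝ) - e) / ((N : ℝ) * ((N : ℝ) - 1)))
          + Real.negMulLog
              (((N : ℝ) - e) * ((N : ℝ) - e - 1) / ((N : ℝ) * ((N : ℝ) - 1))))} := by
    ext x
    simp only [Set.mem_ofPred_eq, Set.mem_singleton_iff]
    constructor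
    · rintro ⟨i, j, hij, rfl⟩
      rw [entropy_one he heN, entropy_one he heN, entropy_two hN he heN i j hij,
        entropy_pure heN.le]
      ring
    · rintro rfl
      have hij : (⟨0, by omega⟩ : Fin N) ≠ ⟨1, by omega⟩ := by simp
      refine ⟨⟨0, by omega⟩, ⟨1, by omega⟩, hij, ?_⟩
      rw [entropy_one he heN, entropy_one he heN, entropy_two hN he heN _ _ hij,
        entropy_pure heN.le]
      ring
  rw [depQ, hset, csInf_singleton]
end

section
/- For integers 0 < e < N define F(N,e) = 2 h(e/N) + λ_1 log λ_1 + λ_2 log λ_2 + λ_3 log λ_3, where h(p) = −p log p − (1−p) log(1−p), λ_1 = e(e−1)/(N(N−1)), λ_2 = 2e(N−e)/(N(N−1)), λ_3 = (N−e)(N−e−1)/(N(N−1)), with natural logarithms and 0 log 0 = 0 (F(N,e) is the N-partite dependence of the N-qubit Dicke state with e excitations). Then: (a) for every fixed e ≥ 1, F(N,e) → 0 as N → ∞; and (b) for every fixed integer k ≥ 2, F(km, m) → (2(k−1)/k²) · log 2 as m → ∞. In particular, for e = N/2 the limiting dependence is (1/2) log 2, the maximum over k. -/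
/-- `F(N,e) = 2 h(e/N) + λ_1 log λ_1 + λ_2 log λ_2 + λ_3 log λ_3`, with
`λ_1 = e(e−1)/(N(N−1))`, `λ_2 = 2e(N−e)/(N(N−1))`, `λ_3 = (N−e)(N−e−1)/(N(N−1))`
(the `N`-partite dependence of the `N`-qubit Dicke state with `e` excitations). -/
noncomputable def FDicke (N e : ℕ) : ℝ :=
  2 * binEnt ((e : ℝ) / N)
    - (Real.negMulLog ((e : ℝ) * ((e : ℝ) - 1) / ((N : ℝ) * ((N : ℝ) - 1)))
      + Real.negMulLog (2 * (e : ℝ) * ((N : ℝ) - e) / ((N : ℝ) * ((N : ℝ) - 1)))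
      + Real.negMulLog
          (((N : ℝ) - e) * ((N : ℝ) - e - 1) / ((N : ℝ) * ((N : ℝ) - 1))))

/-- General limit: if `N → ∞` and `e / N → p`, then `F(N,e) → 2 p (1-p) log 2`. -/
theorem tendsto_FDicke_aux (N e : ℕ → ℕ) (p : ℝ)
    (hN : Filter.Tendsto N Filter.atTop Filter.atTop)
    (he : Filter.Tendsto (fun n => (e n : ℝ) / (N n : ℝ)) Filter.atTop (nhds p)) :
    Filter.Tendsto (fun n => FDicke (N n) (e n)) Filter.atTop
      (nhds (2 * p * (1 - p) * Real.log 2)) := by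
  have hu : Filter.Tendsto (fun n => ((N n : ℝ))⁻¹) Filter.atTop (nhds 0) :=
    tendsto_inv_atTop_zero.comp (tendsto_natCast_atTop_atTop.comp hN)
  have hc := Real.continuous_negMulLog
  have h1 : Filter.Tendsto (fun n => 1 - (N n : ℝ)⁻¹) Filter.atTop (nhds (1 - 0)) :=
    tendsto_const_nhds.sub hu
  have h2 : Filter.Tendsto (fun n => 1 - (e n : ℝ) / (N n : ℝ)) Filter.atTop (nhds (1 - p)) :=
    tendsto_const_nhds.sub he
  have hl1 := (he.mul (he.sub hu)).div h1 (by norm_num)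
  have hl2 := ((he.const_mul 2).mul h2).div h1 (by norm_num)
  have hl3 := (h2.mul (h2.sub hu)).div h1 (by norm_num)
  have key := ((((hc.tendsto _).comp he).add ((hc.tendsto _).comp h2)).const_mul 2).sub
    ((((hc.tendsto _).comp hl1).add ((hc.tendsto _).comp hl2)).add ((hc.tendsto _).comp hl3))
  have hval : 2 * p * (1 - p) * Real.log 2 =
      2 * (Real.negMulLog p + Real.negMulLog (1 - p)) -
        (Real.negMulLog (p * (p - 0) / (1 - 0)) +
          Real.negMulLog (2 * p * (1 - p) / (1 - 0)) +
          Real.negMulLog ((1 - p) * (1 - p - 0) / (1 - 0))) := by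
    have ht : Real.negMulLog 2 = -2 * Real.log 2 := rfl
    simp only [sub_zero, div_one, Real.negMulLog_mul, ht]
    ring
  rw [hval]
  refine key.congr' ?_
  filter_upwards [hN.eventually_ge_atTop 2] with n hn
  have hn' : (2 : ℝ) ≤ (N n : ℝ) := by exact_mod_cast hn
  have hn0 : (N n : ℝ) ≠ 0 := by linarith
  have hn1 : (N n : ℝ) - 1 ≠ 0 := by linarith
  have hn2 : 1 - (N n : ℝ)⁻¹ ≠ 0 := by
    have : 1 - (N n : ℝ)⁻¹ = ((N n : ℝ) - 1) / (N n : ℝ) := by field_simp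
    rw [this]
    exact div_ne_zero hn1 hn0
  have e1 : (e n : ℝ) / N n * ((e n : ℝ) / N n - (N n : ℝ)⁻¹) / (1 - (N n : ℝ)⁻¹) =
      (e n : ℝ) * ((e n : ℝ) - 1) / ((N n : ℝ) * ((N n : ℝ) - 1)) := by
    field_simp
  have e2 : 2 * ((e n : ℝ) / N n) * (1 - (e n : ℝ) / N n) / (1 - (N n : ℝ)⁻¹) =
      2 * (e n : ℝ) * ((N n : ℝ) - e n) / ((N n : ℝ) * ((N n : ℝ) - 1)) := by
    field_simp
  have e3 : (1 - (e n : ℝ) / N n) * (1 - (e n : ℝ) / N n - (N n : ℝ)⁻¹) / (1 - (N n : ℝ)⁻¹) =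
      ((N n : ℝ) - e n) * ((N n : ℝ) - e n - 1) / ((N n : ℝ) * ((N n : ℝ) - 1)) := by
    field_simp
  simp only [Function.comp, Pi.div_apply, FDicke, binEnt, e1, e2, e3]

/-- (a) for every fixed `e ≥ 1`, `F(N,e) → 0` as `N → ∞`;
(b) for every fixed `k ≥ 2`, `F(km, m) → (2(k−1)/k²) log 2` as `m → ∞`;
in particular for `e = N/2` (i.e. `k = 2`) the limiting dependence is
`(1/2) log 2`, which is the maximum of `(2(k−1)/k²) log 2` over `k`. -/
theorem stmt_18 :
    (∀ e : ℕ, 1 ≤ e →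
      Filter.Tendsto (fun N : ℕ => FDicke N e) Filter.atTop (nhds 0)) ∧
    (∀ k : ℕ, 2 ≤ k →
      Filter.Tendsto (fun m : ℕ => FDicke (k * m) m) Filter.atTop
        (nhds ((2 * ((k : ℝ) - 1) / (k : ℝ) ^ 2) * Real.log 2))) ∧
    Filter.Tendsto (fun m : ℕ => FDicke (2 * m) m) Filter.atTop
      (nhds ((1 / 2) * Real.log 2)) ∧
    (∀ k : ℕ, 2 ≤ k →
      (2 * ((k : ℝ) - 1) / (k : ℝ) ^ 2) * Real.log 2 ≤ (1 / 2) * Real.log 2) := by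
  have hb : ∀ k : ℕ, 2 ≤ k →
      Filter.Tendsto (fun m : ℕ => FDicke (k * m) m) Filter.atTop
        (nhds ((2 * ((k : ℝ) - 1) / (k : ℝ) ^ 2) * Real.log 2)) := by
    intro k hk
    have hk0 : (k : ℝ) ≠ 0 := by
      have : k ≠ 0 := by omega
      exact_mod_cast this
    have h := tendsto_FDicke_aux (fun m => k * m) (fun m => m) (1 / (k : ℝ))
      (Filter.tendsto_id.const_mul_atTop' (by omega)) (by
        refine tendsto_const_nhds.congr' ?_
        filter_upwards [Filter.eventually_ge_atTop 1] with m hm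
        have hm0 : (m : ℝ) ≠ 0 := by
          have : m ≠ 0 := by omega
          exact_mod_cast this
        push_cast
        field_simp)
    have hv : (2 * ((k : ℝ) - 1) / (k : ℝ) ^ 2) * Real.log 2 =
        2 * (1 / (k : ℝ)) * (1 - 1 / (k : ℝ)) * Real.log 2 := by
      field_simp
    rw [hv]
    exact h
  refine ⟨?_, hb, ?_, ?_⟩
  · intro e _
    have h := tendsto_FDicke_aux (fun n => n) (fun _ => e) 0 Filter.tendsto_id
      (tendsto_const_div_atTop_nhds_zero_nat (e : ℝ))
    simpa using h
  · have h := hb 2 le_rfl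
    have hv : (2 * (((2 : ℕ) : ℝ) - 1) / ((2 : ℕ) : ℝ) ^ 2) * Real.log 2 =
        (1 / 2) * Real.log 2 := by norm_num
    rw [hv] at h
    exact h
  · intro k hk
    have hk2 : (2 : ℝ) ≤ (k : ℝ) := by exact_mod_cast hk
    refine mul_le_mul_of_nonneg_right ?_ (Real.log_nonneg (by norm_num))
    rw [div_le_div_iff₀ (by positivity) (by norm_num)]
    nlinarith [sq_nonneg ((k : ℝ) - 2)]
end

section
/- Let N ≥ 4 be even. Define the encoding map E_N on 2×2 complex matrices by E_N(ρ) = 2^{−N} ( σ_0^{⊗N} Tr(ρ) + (−1)^{N/2} Σ_{j=1}^3 σ_j^{⊗N} Tr(σ_j^T ρ) ), and the decoding map D_N on 2^N × 2^N complex matrices by D_N(ρ_N) = (1/2) ( σ_0 + (−1)^{N/2} Σ_{j=1}^3 Tr(σ_j^{⊗N} ρ_N) σ_j )^T. Then for every 2×2 complex matrix ρ with Tr(ρ) = 1, the composition recovers the input exactly: D_N(E_N(ρ)) = ρ. (The quantum secret encoded into N shares via the generalized Smolin state is perfectly recoverable when all N shares are combined.) -/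
open Matrix

/-- The Pauli matrices: `pauli 0 = σ_0` (identity), `pauli 1 = σ_1`,
`pauli 2 = σ_2`, `pauli 3 = σ_3`. -/
def pauli : Fin 4 → Matrix (Fin 2) (Fin 2) ℂ
  | 0 => 1
  | 1 => !![0, 1; 1, 0]
  | 2 => !![0, -Complex.I; Complex.I, 0]
  | 3 => !![1, 0; 0, -1]

/-- `N`-fold Kronecker (tensor) power `A^{⊗N}` of a `2 × 2` matrix, as a matrix
indexed by `(Fin N → Fin 2)`. -/
def tpow {N : ℕ} (A : Matrix (Fin 2) (Fin 2) ℂ) :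
    Matrix (Fin N → Fin 2) (Fin N → Fin 2) ℂ :=
  Matrix.of fun x y => ∏ i, A (x i) (y i)

/-- The secret-sharing encoding map whose Choi state is the `N`-qubit generalized
Smolin state:
`E_N(ρ) = 2^{−N} (σ_0^{⊗N} Tr ρ + (−1)^{N/2} Σ_{j=1}^3 σ_j^{⊗N} Tr(σ_j^T ρ))`. -/
noncomputable def encodeS (N : ℕ) (ρ : Matrix (Fin 2) (Fin 2) ℂ) :
    Matrix (Fin N → Fin 2) (Fin N → Fin 2) ℂ :=
  ((2 : ℂ) ^ N)⁻¹ •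
    (ρ.trace • tpow (pauli 0) +
      ((-1 : ℂ) ^ (N / 2)) •
        (((pauli 1)ᵀ * ρ).trace • tpow (pauli 1)
          + ((pauli 2)ᵀ * ρ).trace • tpow (pauli 2)
          + ((pauli 3)ᵀ * ρ).trace • tpow (pauli 3)))

/-- The decoding map
`D_N(ρ_N) = (1/2) (σ_0 + (−1)^{N/2} Σ_{j=1}^3 Tr(σ_j^{⊗N} ρ_N) σ_j)^T`. -/
noncomputable def decodeS (N : ℕ) (ρN : Matrix (Fin N → Fin 2) (Fin N → Fin 2) ℂ) :
    Matrix (Fin 2) (Fin 2) ℂ :=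
  ((1 : ℂ) / 2) •
    (pauli 0 +
      ((-1 : ℂ) ^ (N / 2)) •
        ((tpow (pauli 1) * ρN).trace • pauli 1
          + (tpow (pauli 2) * ρN).trace • pauli 2
          + (tpow (pauli 3) * ρN).trace • pauli 3))ᵀ

theorem tpow_mul_trace {N : ℕ} (A B : Matrix (Fin 2) (Fin 2) ℂ) :
    ((tpow A : Matrix (Fin N → Fin 2) (Fin N → Fin 2) ℂ) * tpow B).trace = (A * B).trace ^ N := by
  have h : ((tpow A : Matrix (Fin N → Fin 2) (Fin N → Fin 2) ℂ) * tpow B) = tpow (A * B) := by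
    ext x y
    simp only [tpow, Matrix.mul_apply, Matrix.of_apply, ← Finset.prod_mul_distrib]
    rw [Finset.prod_univ_sum]
    simp
  rw [h]
  simp only [tpow, Matrix.trace, Matrix.diag_apply, Matrix.of_apply]
  have := (Finset.prod_univ_sum (fun _ : Fin N => (Finset.univ : Finset (Fin 2)))
    (fun _ j => (A * B) j j)).symm
  simpa using this

/-- for even `N ≥ 4` and every `2 × 2` matrix `ρ` with `Tr ρ = 1`,
the quantum secret encoded into `N` shares via the generalized Smolin state is
perfectly recoverable when all `N` shares are combined: `D_N(E_N(ρ)) = ρ`. -/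
theorem stmt_19 {N : ℕ} (hN : 4 ≤ N) (hEven : Even N)
    (ρ : Matrix (Fin 2) (Fin 2) ℂ) (htr : ρ.trace = 1) :
    decodeS N (encodeS N ρ) = ρ := by
  have hN0 : N ≠ 0 := by omega
  have h2 : ((2 : ℂ) ^ N) ≠ 0 := pow_ne_zero _ two_ne_zero
  have hs : ((-1 : ℂ) ^ (N / 2)) * ((-1 : ℂ) ^ (N / 2)) = 1 := by
    rw [← mul_pow]; simp
  have t (i j : Fin 4) : ((pauli i) * (pauli j)).trace = if i = j then 2 else 0 := by
    fin_cases i <;> fin_cases j <;>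
      simp [pauli, Matrix.trace_fin_two, Matrix.mul_apply, Fin.sum_univ_two] <;> norm_num
  have key (s : ℂ) (hs : s * s = 1) (x : ℂ) :
      s * ((2 ^ N : ℂ)⁻¹ * (s * (x * 2 ^ N))) = x := by
    field_simp
    linear_combination x * hs
  unfold decodeS encodeS
  generalize hs' : (-1 : ℂ) ^ (N / 2) = s at *
  simp only [Matrix.mul_smul, Matrix.mul_add, Matrix.trace_smul, Matrix.trace_add,
    tpow_mul_trace, t, smul_eq_mul]
  simp only [Fin.reduceEq, if_true, if_false, zero_pow hN0, mul_zero, zero_add, add_zero,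
    smul_add, smul_smul]
  simp only [key s hs]
  rw [Matrix.trace_fin_two] at htr
  have hI := Complex.I_mul_I
  ext i j
  fin_cases i <;> fin_cases j <;>
    simp [pauli, Matrix.trace_fin_two, Matrix.mul_apply, Fin.sum_univ_two]
  · linear_combination (-1/2) * htr
  · linear_combination (ρ 1 0 / 2 - ρ 0 1 / 2) * hI
  · linear_combination (ρ 0 1 / 2 - ρ 1 0 / 2) * hI
  · linear_combination (-1/2) * htr
end
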